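/- Let Y be a finite set, m ≥ 1, X = {0,1}^m, and W(x)(y) > 0 channel transition probabilities with ∑_{y∈Y} W(x)(y) = 1 for each x. Take the max-log BICM bit metrics q_j(b,y) = max_{x' : x'_j = b} W(x')(y) and the symbol metric q(x,y) = ∏_{j=1}^m q_j(x_j,y). Then for every s > 0 the generalized mutual information of this mismatched decoder with uniform inputs equals the sum of bitwise terms: I_gmi(s) = ∑_{j=1}^m ½ ∑_{b∈{0,1}} ∑_{y∈Y} p_j(y|b) · log( (max_{x : x_j = b} W(x)(y))^s / ( ½ ∑_{b'∈{0,1}} (max_{x : x_j = b'} W(x)(y))^s ) ), where p_j(y|b) = 2^{-(m-1)} ∑_{x : x_j = b} W(x)(y). -/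

import Mathlib

open Real BigOperators Finset

/-- Max-log BICM bit metric `q_j(b,y) = max_{x' : x'_j = b} W(x')(y)`. -/
noncomputable def maxlogBitMetric {Y : Type} [Fintype Y] {m : ℕ}
    (W : (Fin m → Bool) → Y → ℝ) (j : Fin m) (b : Bool) (y : Y) : ℝ :=
  ⨆ x' : {x' : Fin m → Bool // x' j = b}, W x'.1 y

theorem maxlogBitMetric_pos {Y : Type} [Fintype Y] {m : ℕ} {W : (Fin m → Bool) → Y → ℝ}
    (hW : ∀ x y, 0 < W x y) (j : Fin m) (b : Bool) (y : Y) :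
    0 < maxlogBitMetric W j b y :=
  (hW (fun _ => b) y).trans_le <|
    le_ciSup (f := fun x' : {x' : Fin m → Bool // x' j = b} => W x'.1 y)
      (Set.finite_range _).bddAbove ⟨fun _ => b, rfl⟩

/-- The uniform average over labels of a product of bit functions is the product of the
bitwise averages. -/
theorem sum_inv_two_pow_mul_prod (m : ℕ) (f : Fin m → Bool → ℝ) :
    ∑ x : Fin m → Bool, ((2 : ℝ) ^ m)⁻¹ * ∏ j, f j (x j) =
      ∏ j, ((1 / 2 : ℝ) * ∑ b, f j b) := by
  rw [← Finset.mul_sum, Finset.prod_mul_distrib, Fintype.prod_sum]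
  simp

/-- For a product metric, the information density of a symbol is the sum of the information
densities of its bits. -/
theorem log_prod_metric_div (m : ℕ) (q : Fin m → Bool → ℝ) (hq : ∀ j b, 0 < q j b)
    (s : ℝ) (x : Fin m → Bool) :
    Real.log ((∏ j, q j (x j)) ^ s /
        ∑ x' : Fin m → Bool, ((2 : ℝ) ^ m)⁻¹ * (∏ j, q j (x' j)) ^ s) =
      ∑ j, Real.log (q j (x j) ^ s / ((1 / 2 : ℝ) * ∑ b, q j b ^ s)) := by
  have hpow (x : Fin m → Bool) : (∏ j, q j (x j)) ^ s = ∏ j, q j (x j) ^ s :=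
    (Real.finsetProd_rpow _ _ (fun j _ => (hq j (x j)).le) s).symm
  have hpos (j : Fin m) (b : Bool) : 0 < q j b ^ s := Real.rpow_pos_of_pos (hq j b) s
  simp only [hpow]
  rw [sum_inv_two_pow_mul_prod m fun j b => q j b ^ s, ← Finset.prod_div_distrib,
    Real.log_prod]
  intro j _
  have hsum : 0 < ∑ b, q j b ^ s := Finset.sum_pos (fun b _ => hpos j b) Finset.univ_nonempty
  exact (div_pos (hpos j (x j)) (by positivity)).ne'

/-- Summing over a bit and over the labels carrying it is summing over all labels. -/
theorem sum_bool_sum_filter_mul {m : ℕ} (j : Fin m) (w : (Fin m → Bool) → ℝ) (g : Bool → ℝ) :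
    ∑ b, (∑ x ∈ Finset.univ.filter (fun x : Fin m → Bool => x j = b), w x) * g b =
      ∑ x, w x * g (x j) := by
  rw [← Finset.sum_fiberwise (Finset.univ) (fun x : Fin m → Bool => x j)]
  refine Finset.sum_congr rfl fun b _ => ?_
  rw [Finset.sum_mul]
  refine Finset.sum_congr rfl fun x hx => ?_
  rw [(Finset.mem_filter.mp hx).2]

/-- The generalized mutual information of the max-log BICM mismatched decoder (symbol
metric `q(x,y) = ∏_j max_{x' : x'_j = x_j} W(x')(y)`, uniform inputs) equals, for every
`s > 0`, the sum over the label positions of the bitwise terms computed with the bit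
marginals `p_j(y|b) = 2^{-(m-1)} ∑_{x : x_j = b} W(x)(y)`. Natural logarithms. -/
theorem gmi_maxlog_bicm_decomposition {Y : Type} [Fintype Y] (m : ℕ) (hm : 1 ≤ m)
    (W : (Fin m → Bool) → Y → ℝ)
    (hW : ∀ x y, 0 < W x y) (hWs : ∀ x, ∑ y : Y, W x y = 1)
    (s : ℝ) (hs : 0 < s) :
    ∑ x : Fin m → Bool, ((2 : ℝ) ^ m)⁻¹ * ∑ y : Y, W x y *
        Real.log ((∏ j : Fin m, maxlogBitMetric W j (x j) y) ^ s /
          ∑ x' : Fin m → Bool, ((2 : ℝ) ^ m)⁻¹ *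
            (∏ j : Fin m, maxlogBitMetric W j (x' j) y) ^ s) =
      ∑ j : Fin m, (1 / 2 : ℝ) * ∑ b : Bool, ∑ y : Y,
        ((∑ x ∈ Finset.univ.filter (fun x : Fin m → Bool => x j = b), W x y) /
            2 ^ (m - 1)) *
          Real.log (maxlogBitMetric W j b y ^ s /
            ((1 / 2 : ℝ) * ∑ b' : Bool, maxlogBitMetric W j b' y ^ s)) := by
  have htwo : (1 / 2 : ℝ) * (2 ^ (m - 1))⁻¹ = (2 ^ m)⁻¹ := by
    obtain ⟨k, rfl⟩ := Nat.exists_eq_add_of_le' hm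
    rw [Nat.add_sub_cancel, pow_succ, mul_inv, one_div, mul_comm]
  simp_rw [fun x y => log_prod_metric_div m (fun j b => maxlogBitMetric W j b y)
    (fun j b => maxlogBitMetric_pos hW j b y) s x]
  set L : Fin m → Bool → Y → ℝ := fun j b y =>
    Real.log (maxlogBitMetric W j b y ^ s /
      ((1 / 2 : ℝ) * ∑ b' : Bool, maxlogBitMetric W j b' y ^ s))
  have hright (j : Fin m) : (1 / 2 : ℝ) * ∑ b : Bool, ∑ y : Y,
      ((∑ x ∈ Finset.univ.filter (fun x : Fin m → Bool => x j = b), W x y) /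
        2 ^ (m - 1)) * L j b y =
      ((2 : ℝ) ^ m)⁻¹ * ∑ y, ∑ x, W x y * L j (x j) y := by
    rw [← htwo, mul_assoc, Finset.sum_comm, Finset.mul_sum _ _ ((2 : ℝ) ^ (m - 1))⁻¹]
    congr 1
    refine Finset.sum_congr rfl fun y _ => ?_
    rw [← sum_bool_sum_filter_mul j (fun x => W x y) (fun b => L j b y), Finset.mul_sum]
    exact Finset.sum_congr rfl fun b _ => by ring
  refine Eq.trans ?_ (Finset.sum_congr rfl fun j _ => (hright j).symm)
  rw [← Finset.mul_sum, ← Finset.mul_sum, Finset.sum_comm,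
    Finset.sum_comm (s := (univ : Finset (Fin m)))]
  congr 1
  refine Finset.sum_congr rfl fun y _ => ?_
  rw [Finset.sum_comm]
  exact Finset.sum_congr rfl fun x _ => Finset.mul_sum _ _ _
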